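/- Let φ₁, φ₂ : A₄ → PGL(2, ℂ) be injective group homomorphisms, and consider the product action of A₄ × A₄ on ℙ¹(ℂ) × ℙ¹(ℂ), where the first factor acts on the first copy of ℙ¹(ℂ) via φ₁ and the second factor acts on the second copy via φ₂. Then every (A₄ × A₄)-orbit on ℙ¹(ℂ) × ℙ¹(ℂ) of cardinality at most 36 has cardinality 16, 24, or 36; moreover there are exactly four orbits of cardinality 16, exactly four orbits of cardinality 24, and exactly one orbit of cardinality 36. (This is the classification of small orbits of the group Ḡ₁₄₄ ≅ A₄ × A₄ on its invariant smooth quadric surface Q ≅ ℙ¹ × ℙ¹ in ℙ³.) -/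

import Mathlib

noncomputable section

/-- The projective line `ℙ¹(ℂ)`, the projectivization of `ℂ²`. -/
abbrev P1C : Type := Projectivization ℂ (Fin 2 → ℂ)

/-- `PGL(2, ℂ)`, the quotient of `GL(2, ℂ)` by its center. -/
abbrev PGL2C : Type :=
  Matrix.GeneralLinearGroup (Fin 2) ℂ ⧸ Subgroup.center (Matrix.GeneralLinearGroup (Fin 2) ℂ)

lemma GL2_mulVec_ne_zero (g : Matrix.GeneralLinearGroup (Fin 2) ℂ) {v : Fin 2 → ℂ}
    (hv : v ≠ 0) : (g : Matrix (Fin 2) (Fin 2) ℂ).mulVec v ≠ 0 := by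
  intro h
  apply hv
  have h2 : (((g⁻¹ : Matrix.GeneralLinearGroup (Fin 2) ℂ) : Matrix (Fin 2) (Fin 2) ℂ) *
      (g : Matrix (Fin 2) (Fin 2) ℂ)).mulVec v = 0 := by
    rw [← Matrix.mulVec_mulVec, h, Matrix.mulVec_zero]
  rwa [← Units.val_mul, inv_mul_cancel, Units.val_one, Matrix.one_mulVec] at h2

/-- `GL(2, ℂ)` acts on `ℙ¹(ℂ)` via the maps induced on the projectivization by the associated
linear equivalences of `ℂ²`. -/
instance GL2SMulP1 : SMul (Matrix.GeneralLinearGroup (Fin 2) ℂ) P1C :=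
  ⟨fun g x => Projectivization.mk ℂ ((g : Matrix (Fin 2) (Fin 2) ℂ).mulVec x.rep)
    (GL2_mulVec_ne_zero g x.rep_nonzero)⟩

lemma GL2_smul_P1_def (g : Matrix.GeneralLinearGroup (Fin 2) ℂ) (x : P1C) :
    g • x = Projectivization.mk ℂ ((g : Matrix (Fin 2) (Fin 2) ℂ).mulVec x.rep)
      (GL2_mulVec_ne_zero g x.rep_nonzero) := rfl

/-- The action of `GL(2, ℂ)` on `ℙ¹(ℂ)` is a group action. -/
instance GL2MulActionP1 : MulAction (Matrix.GeneralLinearGroup (Fin 2) ℂ) P1C where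
  one_smul x := by
    rw [GL2_smul_P1_def]
    simp only [Units.val_one, Matrix.one_mulVec]
    exact x.mk_rep
  mul_smul g h x := by
    obtain ⟨a, ha⟩ := Projectivization.exists_smul_eq_mk_rep ℂ
      ((h : Matrix (Fin 2) (Fin 2) ℂ).mulVec x.rep) (GL2_mulVec_ne_zero h x.rep_nonzero)
    rw [GL2_smul_P1_def, GL2_smul_P1_def, GL2_smul_P1_def, Projectivization.mk_eq_mk_iff]
    refine ⟨a⁻¹, ?_⟩
    conv_lhs => rw [← ha]
    rw [Matrix.mulVec_smul, ← mul_smul, inv_mul_cancel, one_smul, Units.val_mul,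
      ← Matrix.mulVec_mulVec]

/-- The preimage in `GL(2, ℂ)` of the image of a homomorphism `φ` into `PGL(2, ℂ)`. -/
def glLift {G : Type*} [Group G] (φ : G →* PGL2C) :
    Subgroup (Matrix.GeneralLinearGroup (Fin 2) ℂ) :=
  Subgroup.comap
    (QuotientGroup.mk' (Subgroup.center (Matrix.GeneralLinearGroup (Fin 2) ℂ))) φ.range

/-- The orbit of a point of `ℙ¹(ℂ)` under the action of a group `G` induced by a homomorphism
`φ : G →* PGL(2, ℂ)`: since the center of `GL(2, ℂ)` acts trivially on `ℙ¹(ℂ)`, this is the set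
of translates of the point by the preimage in `GL(2, ℂ)` of the image of `φ`. -/
def orbitOf {G : Type*} [Group G] (φ : G →* PGL2C) (x : P1C) : Set P1C :=
  {y | ∃ g ∈ glLift φ, g • x = y}

/-- The orbit of a point of `ℙ¹(ℂ) × ℙ¹(ℂ)` under the product action of `A₄ × A₄` induced by a
pair of homomorphisms `φ₁, φ₂ : A₄ →* PGL(2, ℂ)`, the `i`-th factor acting on the `i`-th
coordinate. -/
def orbitOf2 {G : Type*} [Group G] (φ₁ φ₂ : G →* PGL2C) (p : P1C × P1C) :
    Set (P1C × P1C) :=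
  {q | ∃ g₁ ∈ glLift φ₁, ∃ g₂ ∈ glLift φ₂, (g₁ • p.1, g₂ • p.2) = q}


namespace TetrahedralAction

open MulAction Matrix

/-! ### Elements of the alternating group on four letters -/

local notation "A₄" => alternatingGroup (Fin 4)

set_option maxRecDepth 100000 in
lemma sq_or_cube_eq_one : ∀ g : A₄, g ^ 2 = 1 ∨ g ^ 3 = 1 := by decide

set_option maxRecDepth 100000 in
lemma conj_involution_ne :
    ∀ c t : A₄, c ^ 3 = 1 → c ≠ 1 → t ^ 2 = 1 → t ≠ 1 → c * t * c⁻¹ ≠ t := by decide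

set_option maxRecDepth 100000 in
lemma mul_involution :
    ∀ s t : A₄, s ^ 2 = 1 → t ^ 2 = 1 → (s * t) ^ 2 = 1 := by decide

set_option maxRecDepth 100000 in
lemma order_three_dichotomy : ∀ c d : A₄, c ^ 3 = 1 → c ≠ 1 → d ^ 3 = 1 → d ≠ 1 →
    (d * c⁻¹) ^ 2 = 1 ∨ (d * c) ^ 2 = 1 := by decide

set_option maxRecDepth 100000 in
lemma involutions_conj :
    ∀ s t : A₄, s ^ 2 = 1 → s ≠ 1 → t ^ 2 = 1 → t ≠ 1 → ∃ g : A₄, g * s * g⁻¹ = t := by decide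

set_option maxRecDepth 100000 in
lemma order_three_conj : ∀ c d : A₄, c ^ 3 = 1 → c ≠ 1 → d ^ 3 = 1 → d ≠ 1 →
    ∃ g : A₄, g * c * g⁻¹ = d ∨ g * c * g⁻¹ = d⁻¹ := by decide

set_option maxRecDepth 100000 in
set_option synthInstance.maxSize 1000 in
lemma order_three_normalizer : ∀ c g : A₄, c ^ 3 = 1 → c ≠ 1 →
    (g⁻¹ * c * g = c ∨ g⁻¹ * c * g = c⁻¹) → g = 1 ∨ g = c ∨ g = c⁻¹ := by decide

set_option maxRecDepth 100000 in
lemma exists_two_involutions : ∃ s t : A₄, s ^ 2 = 1 ∧ s ≠ 1 ∧ t ^ 2 = 1 ∧ t ≠ 1 ∧ s ≠ t := by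
  decide

set_option maxRecDepth 100000 in
lemma exists_order_three : ∃ c : A₄, c ^ 3 = 1 ∧ c ≠ 1 := by decide

lemma eq_one_of_sq_of_cube {G : Type*} [Group G] {g : G} (h2 : g ^ 2 = 1) (h3 : g ^ 3 = 1) :
    g = 1 := by
  rw [pow_succ, h2, one_mul] at h3
  exact h3

lemma conj_smul_eq {G X : Type*} [Group G] [MulAction G X] {g s : G} {x : X} (h : s • x = x) :
    (g * s * g⁻¹) • (g • x) = g • x := by
  rw [smul_smul, inv_mul_cancel_right, mul_smul, h]

/-! ### Actions of `A₄` with the fixed-point behaviour of Möbius transformations -/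

section Abstract

variable {X : Type*} [MulAction A₄ X]

lemma mem_stabilizer_of_involution
    (h3 : ∀ s t : A₄, s ^ 2 = 1 → s ≠ 1 → t ^ 2 = 1 → t ≠ 1 → s ≠ t →
      ∀ x : X, s • x = x → t • x ≠ x)
    {s g : A₄} {x : X} (hs : s ^ 2 = 1) (hs1 : s ≠ 1) (hsx : s • x = x) (hgx : g • x = x) :
    g = 1 ∨ g = s := by
  by_cases hg1 : g = 1
  · exact Or.inl hg1
  rcases sq_or_cube_eq_one g with hg | hg
  · by_contra! h
    exact h3 s g hs hs1 hg hg1 h.2.symm x hsx hgx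
  · have h := conj_smul_eq (g := g) hsx
    rw [hgx] at h
    refine absurd h (h3 s _ hs hs1 ?_ ?_ (conj_involution_ne g s hg hg1 hs hs1).symm x hsx)
    · rw [conj_pow, hs, mul_one, mul_inv_cancel]
    · rwa [Ne, conj_eq_one_iff]

lemma mem_stabilizer_of_order_three
    (h3 : ∀ s t : A₄, s ^ 2 = 1 → s ≠ 1 → t ^ 2 = 1 → t ≠ 1 → s ≠ t →
      ∀ x : X, s • x = x → t • x ≠ x)
    {c g : A₄} {x : X} (hc : c ^ 3 = 1) (hc1 : c ≠ 1) (hcx : c • x = x) (hgx : g • x = x) :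
    g = 1 ∨ g = c ∨ g = c⁻¹ := by
  have key : ∀ t : A₄, t ^ 2 = 1 → t • x = x → t = 1 := by
    intro t ht htx
    by_contra ht1
    rcases mem_stabilizer_of_involution h3 ht ht1 htx hcx with h | h
    · exact hc1 h
    · exact hc1 (eq_one_of_sq_of_cube (h ▸ ht) hc)
  rcases sq_or_cube_eq_one g with hg | hg
  · exact Or.inl (key g hg hgx)
  by_cases hg1 : g = 1
  · exact Or.inl hg1
  have hcx' : c⁻¹ • x = x := by rw [inv_smul_eq_iff, hcx]
  rcases order_three_dichotomy c g hc hc1 hg hg1 with h | h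
  · right; left
    exact mul_inv_eq_one.mp (key _ h (by rw [mul_smul, hcx', hgx]))
  · right; right
    exact eq_inv_of_mul_eq_one_left (key _ h (by rw [mul_smul, hcx, hgx]))

lemma ncard_orbit_mul (x : X) :
    (orbit A₄ x).ncard * ((stabilizer A₄ x : Subgroup A₄) : Set A₄).ncard = 12 := by
  rw [← index_stabilizer, ← Nat.card_coe_set_eq]
  have h := (stabilizer A₄ x).index_mul_card
  rw [nat_card_alternatingGroup] at h
  simpa [Nat.factorial] using h

lemma ncard_orbit_of_involution
    (h3 : ∀ s t : A₄, s ^ 2 = 1 → s ≠ 1 → t ^ 2 = 1 → t ≠ 1 → s ≠ t →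
      ∀ x : X, s • x = x → t • x ≠ x)
    {s : A₄} {x : X} (hs : s ^ 2 = 1) (hs1 : s ≠ 1) (hsx : s • x = x) :
    (orbit A₄ x).ncard = 6 := by
  have h : ((stabilizer A₄ x : Subgroup A₄) : Set A₄) = {1, s} := by
    ext g
    simp only [SetLike.mem_coe, mem_stabilizer_iff, Set.mem_insert_iff, Set.mem_singleton_iff]
    refine ⟨mem_stabilizer_of_involution h3 hs hs1 hsx, ?_⟩
    rintro (rfl | rfl)
    exacts [one_smul _ _, hsx]
  have h12 := ncard_orbit_mul x
  rw [h, Set.ncard_pair hs1.symm] at h12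
  omega

lemma ncard_orbit_of_order_three
    (h3 : ∀ s t : A₄, s ^ 2 = 1 → s ≠ 1 → t ^ 2 = 1 → t ≠ 1 → s ≠ t →
      ∀ x : X, s • x = x → t • x ≠ x)
    {c : A₄} {x : X} (hc : c ^ 3 = 1) (hc1 : c ≠ 1) (hcx : c • x = x) :
    (orbit A₄ x).ncard = 4 := by
  have h : ((stabilizer A₄ x : Subgroup A₄) : Set A₄) = {1, c, c⁻¹} := by
    ext g
    simp only [SetLike.mem_coe, mem_stabilizer_iff, Set.mem_insert_iff, Set.mem_singleton_iff]
    refine ⟨mem_stabilizer_of_order_three h3 hc hc1 hcx, ?_⟩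
    rintro (rfl | rfl | rfl)
    exacts [one_smul _ _, hcx, by rw [inv_smul_eq_iff, hcx]]
  have hne : c ≠ c⁻¹ := fun h => hc1 <| eq_one_of_sq_of_cube
    (by rw [sq]; exact mul_eq_one_iff_eq_inv.mpr h) hc
  have h12 := ncard_orbit_mul x
  rw [h, Set.ncard_eq_three.mpr ⟨1, c, c⁻¹, hc1.symm, (inv_ne_one.mpr hc1).symm, hne, rfl⟩] at h12
  omega

lemma ncard_orbit_of_free {x : X} (h : ∀ g : A₄, g • x = x → g = 1) :
    (orbit A₄ x).ncard = 12 := by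
  have h1 : ((stabilizer A₄ x : Subgroup A₄) : Set A₄) = {1} := by
    ext g
    simp only [SetLike.mem_coe, mem_stabilizer_iff, Set.mem_singleton_iff]
    exact ⟨h g, by rintro rfl; exact one_smul _ _⟩
  have h12 := ncard_orbit_mul x
  rw [h1, Set.ncard_singleton] at h12
  omega

/-- If every nontrivial element of `A₄` has exactly two fixed points and distinct involutions have
no common fixed point, then all orbits have cardinality `4`, `6` or `12`, with exactly two orbits
of cardinality `4` and exactly one of cardinality `6`. -/
theorem orbit_classification
    (h2 : ∀ g : A₄, g ≠ 1 → ∃ p q : X, p ≠ q ∧ ∀ x : X, g • x = x ↔ x = p ∨ x = q)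
    (h3 : ∀ s t : A₄, s ^ 2 = 1 → s ≠ 1 → t ^ 2 = 1 → t ≠ 1 → s ≠ t →
      ∀ x : X, s • x = x → t • x ≠ x) :
    (∀ x : X, (orbit A₄ x).ncard = 4 ∨ (orbit A₄ x).ncard = 6 ∨ (orbit A₄ x).ncard = 12) ∧
    {O : Set X | (∃ x, O = orbit A₄ x) ∧ O.ncard = 4}.ncard = 2 ∧
    {O : Set X | (∃ x, O = orbit A₄ x) ∧ O.ncard = 6}.ncard = 1 := by
  have cases : ∀ x : X, (∃ s : A₄, s ^ 2 = 1 ∧ s ≠ 1 ∧ s • x = x) ∨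
      (∃ c : A₄, c ^ 3 = 1 ∧ c ≠ 1 ∧ c • x = x) ∨ ∀ g : A₄, g • x = x → g = 1 := by
    intro x
    by_cases h : ∀ g : A₄, g • x = x → g = 1
    · exact Or.inr (Or.inr h)
    push Not at h
    obtain ⟨g, hgx, hg1⟩ := h
    rcases sq_or_cube_eq_one g with hg | hg
    · exact Or.inl ⟨g, hg, hg1, hgx⟩
    · exact Or.inr (Or.inl ⟨g, hg, hg1, hgx⟩)
  refine ⟨fun x => ?_, ?_, ?_⟩
  · rcases cases x with ⟨s, hs, hs1, hsx⟩ | ⟨c, hc, hc1, hcx⟩ | h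
    · exact Or.inr (Or.inl (ncard_orbit_of_involution h3 hs hs1 hsx))
    · exact Or.inl (ncard_orbit_of_order_three h3 hc hc1 hcx)
    · exact Or.inr (Or.inr (ncard_orbit_of_free h))
  · obtain ⟨c, hc, hc1⟩ := exists_order_three
    obtain ⟨p, q, hpq, hfix⟩ := h2 c hc1
    have hcp := (hfix p).mpr (Or.inl rfl)
    have hcq := (hfix q).mpr (Or.inr rfl)
    have hne : orbit A₄ p ≠ orbit A₄ q := by
      intro h
      obtain ⟨g, hg⟩ : q ∈ orbit A₄ p := h ▸ mem_orbit_self q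
      change g • p = q at hg
      have hg' : (g⁻¹ * c * g) • p = p := by
        rw [mul_smul, hg, mul_smul, hcq, ← hg, inv_smul_smul]
      have hgp : g • p = p := by
        rcases mem_stabilizer_of_order_three h3 hc hc1 hcp hg' with h | h
        · exact absurd (by simpa [mul_assoc, inv_mul_eq_one] using h) hc1
        · rcases order_three_normalizer c g hc hc1 h with rfl | rfl | rfl
          exacts [one_smul _ _, hcp, by rw [inv_smul_eq_iff, hcp]]
      exact hpq (hgp.symm.trans hg)
    rw [← Set.ncard_pair hne]
    congr 1
    ext O
    simp only [Set.mem_ofPred_eq, Set.mem_insert_iff, Set.mem_singleton_iff]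
    constructor
    · rintro ⟨⟨x, rfl⟩, hO⟩
      rcases cases x with ⟨s, hs, hs1, hsx⟩ | ⟨d, hd, hd1, hdx⟩ | h
      · rw [ncard_orbit_of_involution h3 hs hs1 hsx] at hO
        omega
      · obtain ⟨g, hg⟩ := order_three_conj d c hd hd1 hc hc1
        have hgx := conj_smul_eq (g := g) hdx
        have hcx : c • g • x = g • x := by
          rcases hg with hg | hg
          · rwa [hg] at hgx
          · rwa [hg, inv_smul_eq_iff, eq_comm] at hgx
        rw [← orbit_smul g x]
        rcases (hfix _).mp hcx with h | h
        · exact Or.inl (by rw [h])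
        · exact Or.inr (by rw [h])
      · rw [ncard_orbit_of_free h] at hO
        omega
    · rintro (rfl | rfl)
      exacts [⟨⟨p, rfl⟩, ncard_orbit_of_order_three h3 hc hc1 hcp⟩,
        ⟨⟨q, rfl⟩, ncard_orbit_of_order_three h3 hc hc1 hcq⟩]
  · obtain ⟨s, t, hs, hs1, ht, ht1, hst⟩ := exists_two_involutions
    obtain ⟨p, q, hpq, hfix⟩ := h2 s hs1
    have hsp := (hfix p).mpr (Or.inl rfl)
    have htp : t • p = q := by
      refine ((hfix _).mp ?_).resolve_left (h3 s t hs hs1 ht ht1 hst p hsp)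
      have hcomm : s * t = t * s := by
        have h := mul_involution s t hs ht
        rw [sq] at h hs ht
        rw [eq_inv_of_mul_eq_one_left h, _root_.mul_inv_rev, ← eq_inv_of_mul_eq_one_left hs,
          ← eq_inv_of_mul_eq_one_left ht]
      rw [smul_smul, hcomm, mul_smul, hsp]
    rw [Set.ncard_eq_one]
    refine ⟨orbit A₄ p, ?_⟩
    ext O
    simp only [Set.mem_ofPred_eq, Set.mem_singleton_iff]
    constructor
    · rintro ⟨⟨x, rfl⟩, hO⟩
      rcases cases x with ⟨u, hu, hu1, hux⟩ | ⟨d, hd, hd1, hdx⟩ | h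
      · obtain ⟨g, hg⟩ := involutions_conj u s hu hu1 hs hs1
        have hgx := conj_smul_eq (g := g) hux
        rw [hg] at hgx
        rw [← orbit_smul g x]
        rcases (hfix _).mp hgx with h | h
        · rw [h]
        · rw [h, ← htp, orbit_smul]
      · rw [ncard_orbit_of_order_three h3 hd hd1 hdx] at hO
        omega
      · rw [ncard_orbit_of_free h] at hO
        omega
    · rintro rfl
      exact ⟨⟨p, rfl⟩, ncard_orbit_of_involution h3 hs hs1 hsp⟩

end Abstract

/-! ### The action of `PGL(2, ℂ)` on `ℙ¹(ℂ)` -/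

lemma smul_eq_self_iff (g : GL (Fin 2) ℂ) (x : P1C) :
    g • x = x ↔ ∃ a : ℂ, (g : Matrix (Fin 2) (Fin 2) ℂ) *ᵥ x.rep = a • x.rep := by
  rw [GL2_smul_P1_def]
  conv_lhs => rhs; rw [← x.mk_rep]
  rw [Projectivization.mk_eq_mk_iff']
  simp only [eq_comm]

lemma smul_mk_eq_self {g : GL (Fin 2) ℂ} {v : Fin 2 → ℂ} (hv : v ≠ 0) {a : ℂ}
    (h : (g : Matrix (Fin 2) (Fin 2) ℂ) *ᵥ v = a • v) :
    g • Projectivization.mk ℂ v hv = Projectivization.mk ℂ v hv := by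
  obtain ⟨b, hb⟩ := Projectivization.exists_smul_eq_mk_rep ℂ v hv
  rw [smul_eq_self_iff]
  refine ⟨a, ?_⟩
  rw [← hb, mulVec_smul, h, smul_comm]

lemma mem_center_iff (g : GL (Fin 2) ℂ) : g ∈ Subgroup.center (GL (Fin 2) ℂ) ↔
    g.val 0 1 = 0 ∧ g.val 1 0 = 0 ∧ g.val 0 0 = g.val 1 1 := by
  rw [GeneralLinearGroup.mem_center_iff_val_mem_range_scalar]
  constructor
  · rintro ⟨a, ha⟩
    simp [← ha]
  · rintro ⟨h01, h10, h⟩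
    refine ⟨g.val 0 0, ?_⟩
    ext i j
    fin_cases i <;> fin_cases j <;> simp [h01, h10, h]

lemma center_smul {g : GL (Fin 2) ℂ} (hg : g ∈ Subgroup.center (GL (Fin 2) ℂ)) (x : P1C) :
    g • x = x := by
  obtain ⟨a, ha⟩ := GeneralLinearGroup.mem_center_iff_val_mem_range_scalar.mp hg
  rw [smul_eq_self_iff]
  exact ⟨a, by rw [← ha, scalar_apply, ← smul_one_eq_diagonal, smul_mulVec, one_mulVec]⟩

/-- The permutation action of `PGL(2, ℂ)` on `ℙ¹(ℂ)`. -/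
def pglToPerm : PGL2C →* Equiv.Perm P1C :=
  QuotientGroup.lift _ (toPermHom (GL (Fin 2) ℂ) P1C) fun _ hg =>
    MonoidHom.mem_ker.mpr (Equiv.ext fun x => center_smul hg x)

instance : MulAction PGL2C P1C := MulAction.compHom P1C pglToPerm

lemma mk_smul (g : GL (Fin 2) ℂ) (x : P1C) : (QuotientGroup.mk g : PGL2C) • x = g • x := rfl

lemma trace_eq_zero {g : GL (Fin 2) ℂ} (hg : g ∉ Subgroup.center (GL (Fin 2) ℂ))
    (h : g ^ 2 ∈ Subgroup.center (GL (Fin 2) ℂ)) : g.val 0 0 + g.val 1 1 = 0 := by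
  rw [mem_center_iff] at hg h
  simp only [sq, Units.val_mul, mul_apply, Fin.sum_univ_two] at h
  obtain ⟨h1, h2, h3⟩ := h
  by_contra ht
  refine hg ⟨mul_right_cancel₀ ht ?_, mul_right_cancel₀ ht ?_,
    sub_eq_zero.mp (mul_right_cancel₀ ht ?_)⟩
  · linear_combination h1
  · linear_combination h2
  · linear_combination h3

lemma trace_sq_eq_det {g : GL (Fin 2) ℂ} (hg : g ∉ Subgroup.center (GL (Fin 2) ℂ))
    (h : g ^ 3 ∈ Subgroup.center (GL (Fin 2) ℂ)) :
    (g.val 0 0 + g.val 1 1) ^ 2 - g.val.det = 0 := by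
  rw [mem_center_iff] at hg h
  simp only [pow_succ, pow_zero, one_mul, Units.val_mul, mul_apply, Fin.sum_univ_two] at h
  obtain ⟨h1, h2, h3⟩ := h
  rw [det_fin_two]
  by_contra ht
  refine hg ⟨mul_right_cancel₀ ht ?_, mul_right_cancel₀ ht ?_,
    sub_eq_zero.mp (mul_right_cancel₀ ht ?_)⟩
  · linear_combination h1
  · linear_combination h2
  · linear_combination h3

lemma charpoly_eq_zero {M : Matrix (Fin 2) (Fin 2) ℂ} {v : Fin 2 → ℂ} (hv : v ≠ 0) {a : ℂ}
    (h : M *ᵥ v = a • v) : a ^ 2 - (M 0 0 + M 1 1) * a + M.det = 0 := by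
  have h0 : (M - a • (1 : Matrix (Fin 2) (Fin 2) ℂ)).det = 0 :=
    exists_mulVec_eq_zero_iff.mp ⟨v, hv, by rw [sub_mulVec, smul_mulVec, one_mulVec, h, sub_self]⟩
  simp [det_fin_two] at h0
  rw [det_fin_two]
  linear_combination h0

lemma exists_eigenvector {M : Matrix (Fin 2) (Fin 2) ℂ} {a : ℂ}
    (h : a ^ 2 - (M 0 0 + M 1 1) * a + M.det = 0) : ∃ v : Fin 2 → ℂ, v ≠ 0 ∧ M *ᵥ v = a • v := by
  have h0 : (M - a • (1 : Matrix (Fin 2) (Fin 2) ℂ)).det = 0 := by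
    rw [det_fin_two] at h
    simp [det_fin_two]
    linear_combination h
  obtain ⟨v, hv, hMv⟩ := exists_mulVec_eq_zero_iff.mpr h0
  refine ⟨v, hv, ?_⟩
  rwa [sub_mulVec, smul_mulVec, one_mulVec, sub_eq_zero] at hMv

lemma exists_smul_eq_of_cross_eq_zero {u v : Fin 2 → ℂ} (hv : v ≠ 0)
    (h : u 0 * v 1 - u 1 * v 0 = 0) : ∃ b : ℂ, b • v = u := by
  by_cases h0 : v 0 = 0
  · have h1 : v 1 ≠ 0 := fun h1 => hv (by ext i; fin_cases i <;> simp [h0, h1])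
    have hu : u 0 = 0 := by simpa [h0, h1] using h
    refine ⟨u 1 / v 1, ?_⟩
    ext i
    fin_cases i <;> simp [h0, hu, h1]
  · refine ⟨u 0 / v 0, ?_⟩
    ext i
    fin_cases i
    · simp [h0]
    · simp only [Fin.mk_one, Pi.smul_apply, smul_eq_mul]
      field_simp
      linear_combination h

lemma cross_mul_eq_zero {M : Matrix (Fin 2) (Fin 2) ℂ} {u v : Fin 2 → ℂ} {a : ℂ}
    (hu : M *ᵥ u = a • u) (hv : M *ᵥ v = a • v) :
    (u 0 * v 1 - u 1 * v 0) * (M 0 0 + M 1 1 - 2 * a) = 0 := by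
  have hu0 := congrFun hu 0
  have hu1 := congrFun hu 1
  have hv0 := congrFun hv 0
  have hv1 := congrFun hv 1
  simp only [mulVec, dotProduct, Fin.sum_univ_two, Pi.smul_apply, smul_eq_mul] at hu0 hu1 hv0 hv1
  linear_combination v 1 * hu0 - v 0 * hu1 + u 0 * hv1 - u 1 * hv0

lemma exists_two_fixed_points {g : GL (Fin 2) ℂ}
    (hD : (g.val 0 0 + g.val 1 1) ^ 2 - 4 * g.val.det ≠ 0) :
    ∃ p q : P1C, p ≠ q ∧ ∀ x : P1C, g • x = x ↔ x = p ∨ x = q := by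
  set M := g.val with hM
  obtain ⟨s, hs⟩ := IsAlgClosed.exists_pow_nat_eq ((M 0 0 + M 1 1) ^ 2 - 4 * M.det) two_pos
  have hs0 : s ≠ 0 := by
    rintro rfl
    exact hD (by rw [← hs]; ring)
  have factor : ∀ a : ℂ, a ^ 2 - (M 0 0 + M 1 1) * a + M.det =
      (a - (M 0 0 + M 1 1 + s) / 2) * (a - (M 0 0 + M 1 1 - s) / 2) := by
    intro a
    linear_combination hs / 4
  obtain ⟨v, hv, hMv⟩ := exists_eigenvector (M := M) (a := (M 0 0 + M 1 1 + s) / 2)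
    (by rw [factor]; ring)
  obtain ⟨w, hw, hMw⟩ := exists_eigenvector (M := M) (a := (M 0 0 + M 1 1 - s) / 2)
    (by rw [factor]; ring)
  have eq_mk : ∀ (x : P1C) (a : ℂ) (u : Fin 2 → ℂ) (hu : u ≠ 0), M 0 0 + M 1 1 - 2 * a ≠ 0 →
      M *ᵥ x.rep = a • x.rep → M *ᵥ u = a • u → x = Projectivization.mk ℂ u hu := by
    intro x a u hu ha hx hMu
    rw [← x.mk_rep, Projectivization.mk_eq_mk_iff']
    exact exists_smul_eq_of_cross_eq_zero hu
      ((mul_eq_zero.mp (cross_mul_eq_zero hx hMu)).resolve_right ha)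
  refine ⟨Projectivization.mk ℂ v hv, Projectivization.mk ℂ w hw, ?_, fun x => ⟨fun hx => ?_, ?_⟩⟩
  · rw [Ne, Projectivization.mk_eq_mk_iff']
    rintro ⟨b, rfl⟩
    rw [mulVec_smul, hMw, smul_comm] at hMv
    have h := smul_left_injective ℂ hv hMv
    exact hs0 (by linear_combination -h)
  · obtain ⟨a, ha⟩ := (smul_eq_self_iff g x).mp hx
    have h := charpoly_eq_zero x.rep_nonzero ha
    rw [← hM, factor, mul_eq_zero, sub_eq_zero, sub_eq_zero] at h
    rcases h with rfl | rfl
    · exact Or.inl (eq_mk x _ v hv (by ring_nf; exact neg_ne_zero.mpr hs0) ha hMv)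
    · exact Or.inr (eq_mk x _ w hw (by ring_nf; exact hs0) ha hMw)
  · rintro (rfl | rfl)
    exacts [smul_mk_eq_self hv hMv, smul_mk_eq_self hw hMw]

lemma pgl_exists_two_fixed_points {γ : PGL2C} (hγ : γ ≠ 1) (h : γ ^ 2 = 1 ∨ γ ^ 3 = 1) :
    ∃ p q : P1C, p ≠ q ∧ ∀ x : P1C, γ • x = x ↔ x = p ∨ x = q := by
  obtain ⟨g, rfl⟩ := QuotientGroup.mk_surjective γ
  rw [← QuotientGroup.mk_pow, ← QuotientGroup.mk_pow, QuotientGroup.eq_one_iff,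
    QuotientGroup.eq_one_iff] at h
  rw [Ne, QuotientGroup.eq_one_iff] at hγ
  simp only [mk_smul]
  have hdet : g.val.det ≠ 0 := g.det_ne_zero
  apply exists_two_fixed_points
  rcases h with h | h
  · rw [trace_eq_zero hγ h]
    simpa using hdet
  · have h3 := trace_sq_eq_det hγ h
    intro h0
    exact hdet (by linear_combination (h3 - h0) / 3)

lemma eigenvalue_sq {g : GL (Fin 2) ℂ} (hg : g ∉ Subgroup.center (GL (Fin 2) ℂ))
    (h : g ^ 2 ∈ Subgroup.center (GL (Fin 2) ℂ)) {v : Fin 2 → ℂ} (hv : v ≠ 0) {a : ℂ}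
    (ha : g.val *ᵥ v = a • v) : a ^ 2 = -g.val.det := by
  have h0 := charpoly_eq_zero hv ha
  rw [trace_eq_zero hg h] at h0
  linear_combination h0

/-- Two distinct commuting involutions of `PGL(2, ℂ)` have no common fixed point. -/
lemma pgl_involutions_no_common_fixed_point {σ τ : PGL2C} (hσ : σ ≠ 1) (hσ2 : σ ^ 2 = 1)
    (hτ : τ ≠ 1) (hτ2 : τ ^ 2 = 1) (hστ : σ * τ ≠ 1) (hστ2 : (σ * τ) ^ 2 = 1) (x : P1C)
    (hσx : σ • x = x) : τ • x ≠ x := by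
  intro hτx
  obtain ⟨g, rfl⟩ := QuotientGroup.mk_surjective σ
  obtain ⟨k, rfl⟩ := QuotientGroup.mk_surjective τ
  rw [mk_smul, smul_eq_self_iff] at hσx hτx
  obtain ⟨a, ha⟩ := hσx
  obtain ⟨b, hb⟩ := hτx
  rw [← QuotientGroup.mk_mul] at hστ hστ2
  rw [← QuotientGroup.mk_pow, QuotientGroup.eq_one_iff] at hσ2 hτ2 hστ2
  rw [Ne, QuotientGroup.eq_one_iff] at hσ hτ hστ
  have hab : (g * k).val *ᵥ x.rep = (a * b) • x.rep := by
    rw [Units.val_mul, ← mulVec_mulVec, hb, mulVec_smul, ha, smul_smul, mul_comm]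
  have h1 := eigenvalue_sq hσ hσ2 x.rep_nonzero ha
  have h2 := eigenvalue_sq hτ hτ2 x.rep_nonzero hb
  have h3 := eigenvalue_sq hστ hστ2 x.rep_nonzero hab
  rw [Units.val_mul, det_mul, mul_pow, h1, h2] at h3
  have h4 : g.val.det * k.val.det = 0 := by linear_combination h3 / 2
  exact mul_ne_zero g.det_ne_zero k.det_ne_zero h4

/-! ### Orbits of `A₄` on `ℙ¹(ℂ)` and of `A₄ × A₄` on `ℙ¹(ℂ) × ℙ¹(ℂ)` -/

theorem orbitOf_classification (φ : A₄ →* PGL2C) (hφ : Function.Injective φ) :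
    (∀ x, (orbitOf φ x).ncard = 4 ∨ (orbitOf φ x).ncard = 6 ∨ (orbitOf φ x).ncard = 12) ∧
    {O | (∃ x, O = orbitOf φ x) ∧ O.ncard = 4}.ncard = 2 ∧
    {O | (∃ x, O = orbitOf φ x) ∧ O.ncard = 6}.ncard = 1 := by
  let _ : MulAction A₄ P1C := MulAction.compHom P1C φ
  have smul_def : ∀ (g : A₄) (x : P1C), g • x = φ g • x := fun _ _ => rfl
  have horb : ∀ x, orbitOf φ x = orbit A₄ x := by
    intro x
    ext y
    constructor
    · rintro ⟨g, ⟨a, ha⟩, rfl⟩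
      exact ⟨a, congrArg (fun γ : PGL2C => γ • x) ha⟩
    · rintro ⟨a, rfl⟩
      obtain ⟨g, hg⟩ := QuotientGroup.mk_surjective (φ a)
      exact ⟨g, ⟨a, hg.symm⟩, congrArg (fun γ : PGL2C => γ • x) hg⟩
  have hne : ∀ {g : A₄}, g ≠ 1 → φ g ≠ 1 := fun h => (map_ne_one_iff φ hφ).mpr h
  simp only [horb]
  refine orbit_classification (fun g hg => ?_) fun s t hs hs1 ht ht1 hst x => ?_
  · refine pgl_exists_two_fixed_points (hne hg) ?_
    rw [← map_pow, ← map_pow]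
    exact (sq_or_cube_eq_one g).imp (fun h => by rw [h, map_one]) (fun h => by rw [h, map_one])
  · refine pgl_involutions_no_common_fixed_point (hne hs1) (by rw [← map_pow, hs, map_one])
      (hne ht1) (by rw [← map_pow, ht, map_one]) ?_
      (by rw [← map_mul, ← map_pow, mul_involution s t hs ht, map_one]) x
    rw [← map_mul]
    refine hne fun h => hst ?_
    rw [eq_inv_of_mul_eq_one_left h]
    rw [sq] at ht
    exact (eq_inv_of_mul_eq_one_left ht).symm

lemma orbitOf_nonempty {G : Type*} [Group G] (φ : G →* PGL2C) (x : P1C) :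
    (orbitOf φ x).Nonempty :=
  ⟨x, 1, one_mem _, one_smul _ _⟩

lemma orbitOf2_eq_prod {G : Type*} [Group G] (φ₁ φ₂ : G →* PGL2C) (p : P1C × P1C) :
    orbitOf2 φ₁ φ₂ p = orbitOf φ₁ p.1 ×ˢ orbitOf φ₂ p.2 := by
  ext ⟨y, z⟩
  constructor
  · rintro ⟨g, hg, k, hk, h⟩
    rw [Prod.mk.injEq] at h
    exact ⟨⟨g, hg, h.1⟩, ⟨k, hk, h.2⟩⟩
  · rintro ⟨⟨g, hg, rfl⟩, ⟨k, hk, rfl⟩⟩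
    exact ⟨g, hg, k, hk, rfl⟩

/-- The orbits of cardinality `n` under the action induced by `φ`. -/
def orbitsOfCard {G : Type*} [Group G] (φ : G →* PGL2C) (n : ℕ) : Set (Set P1C) :=
  {O | (∃ x, O = orbitOf φ x) ∧ O.ncard = n}

lemma prod_injOn {G : Type*} [Group G] (φ₁ φ₂ : G →* PGL2C) (m n : ℕ) :
    Set.InjOn (fun O : Set P1C × Set P1C => O.1 ×ˢ O.2)
      (orbitsOfCard φ₁ m ×ˢ orbitsOfCard φ₂ n) := by
  rintro ⟨O₁, O₂⟩ ⟨⟨⟨x, rfl⟩, -⟩, ⟨⟨y, rfl⟩, -⟩⟩ ⟨O₁', O₂'⟩ - h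
  rw [Set.prod_eq_prod_iff_of_nonempty
    ((orbitOf_nonempty φ₁ x).prod (orbitOf_nonempty φ₂ y))] at h
  exact Prod.ext h.1 h.2

/-- The products of an orbit of cardinality `m` with an orbit of cardinality `n`. -/
def prodOrbits {G : Type*} [Group G] (φ₁ φ₂ : G →* PGL2C) (m n : ℕ) : Set (Set (P1C × P1C)) :=
  (fun O : Set P1C × Set P1C => O.1 ×ˢ O.2) '' (orbitsOfCard φ₁ m ×ˢ orbitsOfCard φ₂ n)

lemma ncard_prodOrbits {G : Type*} [Group G] (φ₁ φ₂ : G →* PGL2C) (m n : ℕ) :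
    (prodOrbits φ₁ φ₂ m n).ncard = (orbitsOfCard φ₁ m).ncard * (orbitsOfCard φ₂ n).ncard := by
  rw [prodOrbits, (prod_injOn φ₁ φ₂ m n).ncard_image, Set.ncard_prod]

lemma mem_prodOrbits {G : Type*} [Group G] {φ₁ φ₂ : G →* PGL2C} {m n : ℕ}
    {O : Set (P1C × P1C)} : O ∈ prodOrbits φ₁ φ₂ m n ↔
      ∃ p, O = orbitOf2 φ₁ φ₂ p ∧ (orbitOf φ₁ p.1).ncard = m ∧ (orbitOf φ₂ p.2).ncard = n := by
  constructor
  · rintro ⟨⟨O₁, O₂⟩, ⟨⟨⟨x, rfl⟩, hm⟩, ⟨⟨y, rfl⟩, hn⟩⟩, rfl⟩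
    exact ⟨(x, y), (orbitOf2_eq_prod φ₁ φ₂ (x, y)).symm, hm, hn⟩
  · rintro ⟨p, rfl, hm, hn⟩
    exact ⟨(orbitOf φ₁ p.1, orbitOf φ₂ p.2), ⟨⟨⟨_, rfl⟩, hm⟩, ⟨⟨_, rfl⟩, hn⟩⟩,
      (orbitOf2_eq_prod φ₁ φ₂ p).symm⟩

end TetrahedralAction

open TetrahedralAction

/-- For injective homomorphisms `φ₁, φ₂ : A₄ → PGL(2, ℂ)` and the induced product action of
`A₄ × A₄` on `ℙ¹(ℂ) × ℙ¹(ℂ)`: every orbit of cardinality at most `36` has cardinality `16`,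
`24`, or `36`; there are exactly four orbits of cardinality `16`, exactly four orbits of
cardinality `24`, and exactly one orbit of cardinality `36`. -/
theorem A4_prod_A4_orbits_on_P1_prod_P1
    (φ₁ φ₂ : alternatingGroup (Fin 4) →* PGL2C)
    (hφ₁ : Function.Injective φ₁) (hφ₂ : Function.Injective φ₂) :
    (∀ p : P1C × P1C, (orbitOf2 φ₁ φ₂ p).ncard ≤ 36 →
      (orbitOf2 φ₁ φ₂ p).ncard = 16 ∨ (orbitOf2 φ₁ φ₂ p).ncard = 24 ∨
        (orbitOf2 φ₁ φ₂ p).ncard = 36) ∧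
    {O : Set (P1C × P1C) | (∃ p, O = orbitOf2 φ₁ φ₂ p) ∧ O.ncard = 16}.ncard = 4 ∧
    {O : Set (P1C × P1C) | (∃ p, O = orbitOf2 φ₁ φ₂ p) ∧ O.ncard = 24}.ncard = 4 ∧
    {O : Set (P1C × P1C) | (∃ p, O = orbitOf2 φ₁ φ₂ p) ∧ O.ncard = 36}.ncard = 1 := by
  obtain ⟨h₁, h₁4, h₁6⟩ := orbitOf_classification φ₁ hφ₁
  obtain ⟨h₂, h₂4, h₂6⟩ := orbitOf_classification φ₂ hφ₂
  have hcard : ∀ p, (orbitOf2 φ₁ φ₂ p).ncard =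
      (orbitOf φ₁ p.1).ncard * (orbitOf φ₂ p.2).ncard := by
    intro p
    rw [orbitOf2_eq_prod, Set.ncard_prod]
  refine ⟨fun p hp => ?_, ?_, ?_, ?_⟩
  · rw [hcard] at hp ⊢
    rcases h₁ p.1 with h | h | h <;> rcases h₂ p.2 with h' | h' | h' <;>
      rw [h, h'] at hp ⊢ <;> omega
  · have hset : {O : Set (P1C × P1C) | (∃ p, O = orbitOf2 φ₁ φ₂ p) ∧ O.ncard = 16} =
        prodOrbits φ₁ φ₂ 4 4 := by
      ext O
      rw [mem_prodOrbits]
      constructor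
      · rintro ⟨⟨p, rfl⟩, hO⟩
        refine ⟨p, rfl, ?_⟩
        rw [hcard] at hO
        rcases h₁ p.1 with h | h | h <;> rcases h₂ p.2 with h' | h' | h' <;>
          rw [h, h'] at hO ⊢ <;> omega
      · rintro ⟨p, rfl, h, h'⟩
        exact ⟨⟨p, rfl⟩, by rw [hcard, h, h']⟩
    rw [hset, ncard_prodOrbits, orbitsOfCard, orbitsOfCard, h₁4, h₂4]
  · have hset : {O : Set (P1C × P1C) | (∃ p, O = orbitOf2 φ₁ φ₂ p) ∧ O.ncard = 24} =
        prodOrbits φ₁ φ₂ 4 6 ∪ prodOrbits φ₁ φ₂ 6 4 := by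
      ext O
      rw [Set.mem_union, mem_prodOrbits, mem_prodOrbits]
      constructor
      · rintro ⟨⟨p, rfl⟩, hO⟩
        have key : ((orbitOf φ₁ p.1).ncard = 4 ∧ (orbitOf φ₂ p.2).ncard = 6) ∨
            ((orbitOf φ₁ p.1).ncard = 6 ∧ (orbitOf φ₂ p.2).ncard = 4) := by
          rw [hcard] at hO
          rcases h₁ p.1 with h | h | h <;> rcases h₂ p.2 with h' | h' | h' <;>
            rw [h, h'] at hO ⊢ <;> omega
        exact key.imp (fun h => ⟨p, rfl, h⟩) (fun h => ⟨p, rfl, h⟩)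
      · rintro (⟨p, rfl, h, h'⟩ | ⟨p, rfl, h, h'⟩) <;>
          exact ⟨⟨p, rfl⟩, by rw [hcard, h, h']⟩
    have hdisj : Disjoint (prodOrbits φ₁ φ₂ 4 6) (prodOrbits φ₁ φ₂ 6 4) := by
      rw [Set.disjoint_left]
      intro O hO hO'
      obtain ⟨p, rfl, h, -⟩ := mem_prodOrbits.mp hO
      obtain ⟨q, hpq, h', -⟩ := mem_prodOrbits.mp hO'
      rw [orbitOf2_eq_prod, orbitOf2_eq_prod, Set.prod_eq_prod_iff_of_nonempty
        ((orbitOf_nonempty φ₁ p.1).prod (orbitOf_nonempty φ₂ p.2))] at hpq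
      rw [hpq.1] at h
      omega
    have h46 : (prodOrbits φ₁ φ₂ 4 6).ncard = 2 := by
      rw [ncard_prodOrbits, orbitsOfCard, orbitsOfCard, h₁4, h₂6]
    have h64 : (prodOrbits φ₁ φ₂ 6 4).ncard = 2 := by
      rw [ncard_prodOrbits, orbitsOfCard, orbitsOfCard, h₁6, h₂4]
    rw [hset, Set.ncard_union_eq hdisj (Set.finite_of_ncard_pos (by omega))
      (Set.finite_of_ncard_pos (by omega)), h46, h64]
  · have hset : {O : Set (P1C × P1C) | (∃ p, O = orbitOf2 φ₁ φ₂ p) ∧ O.ncard = 36} =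
        prodOrbits φ₁ φ₂ 6 6 := by
      ext O
      rw [mem_prodOrbits]
      constructor
      · rintro ⟨⟨p, rfl⟩, hO⟩
        refine ⟨p, rfl, ?_⟩
        rw [hcard] at hO
        rcases h₁ p.1 with h | h | h <;> rcases h₂ p.2 with h' | h' | h' <;>
          rw [h, h'] at hO ⊢ <;> omega
      · rintro ⟨p, rfl, h, h'⟩
        exact ⟨⟨p, rfl⟩, by rw [hcard, h, h']⟩
    rw [hset, ncard_prodOrbits, orbitsOfCard, orbitsOfCard, h₁6, h₂6]

end
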